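/- arXiv:1206.4395 — 2 statements merged into one kernel-verified Lean document; each statement's English description precedes it below -/
import Mathlib

section
/- In the polynomial ring ℂ[y₁,x₁,h₁,y₂,y₃,x₂,x₃,h₀], the five polynomials I₁ = h₀, I₂ = h₁² + 4x₁y₁, I₃ = x₂y₂ + x₃y₃, I₄ = h₁y₂y₃ + y₁y₂² − x₁y₃², I₅ = h₁x₂x₃ + x₁x₂² − x₃²y₁ are algebraically independent over ℂ. -/
open MvPolynomial

/-- Variables: `0 ↦ y₁, 1 ↦ x₁, 2 ↦ h₁, 3 ↦ y₂, 4 ↦ y₃, 5 ↦ x₂, 6 ↦ x₃, 7 ↦ h₀`. -/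
noncomputable abbrev y₁ : MvPolynomial (Fin 8) ℂ := X 0
noncomputable abbrev x₁ : MvPolynomial (Fin 8) ℂ := X 1
noncomputable abbrev h₁ : MvPolynomial (Fin 8) ℂ := X 2
noncomputable abbrev y₂ : MvPolynomial (Fin 8) ℂ := X 3
noncomputable abbrev y₃ : MvPolynomial (Fin 8) ℂ := X 4
noncomputable abbrev x₂ : MvPolynomial (Fin 8) ℂ := X 5
noncomputable abbrev x₃ : MvPolynomial (Fin 8) ℂ := X 6
noncomputable abbrev h₀ : MvPolynomial (Fin 8) ℂ := X 7

noncomputable def I₁ : MvPolynomial (Fin 8) ℂ := h₀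
noncomputable def I₂ : MvPolynomial (Fin 8) ℂ := h₁ ^ 2 + 4 * (x₁ * y₁)
noncomputable def I₃ : MvPolynomial (Fin 8) ℂ := x₂ * y₂ + x₃ * y₃
noncomputable def I₄ : MvPolynomial (Fin 8) ℂ := h₁ * (y₂ * y₃) + y₁ * y₂ ^ 2 - x₁ * y₃ ^ 2
noncomputable def I₅ : MvPolynomial (Fin 8) ℂ := h₁ * (x₂ * x₃) + x₁ * x₂ ^ 2 - x₃ ^ 2 * y₁
noncomputable def I₆ : MvPolynomial (Fin 8) ℂ :=
  h₁ * (x₂ * y₂ - x₃ * y₃) - 2 * (y₁ * y₂ * x₃ + x₁ * x₂ * y₃)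

/-- The map `ℂ⁸ → ℂ⁵` given by the five invariants hits every point with nonzero fourth
coordinate. -/
lemma exists_eval_invariants_eq (v : Fin 5 → ℂ) (hv : v 3 ≠ 0) :
    ∃ w : Fin 8 → ℂ, ∀ i, aeval w (![I₁, I₂, I₃, I₄, I₅] i) = v i := by
  obtain ⟨s, hs⟩ := IsAlgClosed.exists_pow_nat_eq
    ((v 1 / (4 * v 3) * v 2 ^ 2 - v 4) / v 3) (n := 2) (by norm_num)
  refine ⟨![v 3, v 1 / (4 * v 3), 0, 1, 0, v 2, s, v 0], fun i => ?_⟩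
  fin_cases i
  · simp [I₁]
  · simp [I₂]
    field_simp
  · simp [I₃]
  · simp [I₄]
  · simp [I₅, hs]
    field_simp
    ring

/-- The five invariants `I₁, I₂, I₃, I₄, I₅` are algebraically independent over `ℂ`. -/
theorem invariants_algebraically_independent :
    AlgebraicIndependent ℂ ![I₁, I₂, I₃, I₄, I₅] := by
  rw [algebraicIndependent_iff]
  intro p hp
  have hmul : p * X 3 = 0 := by
    refine MvPolynomial.funext fun v => ?_
    by_cases hv : v 3 = 0
    · simp [hv]
    obtain ⟨w, hw⟩ := exists_eval_invariants_eq v hv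
    have hpv : eval v p = 0 := by
      have h := congrArg (aeval w) hp
      rw [comp_aeval_apply, map_zero] at h
      simp only [hw] at h
      exact h
    simp [hpv]
  exact (mul_eq_zero.mp hmul).resolve_right (X_ne_zero 3)
end

section
/- In the polynomial ring ℂ[y₁,x₁,h₁,y₂,y₃,x₂,x₃,h₀], set h₂ = h₀ − h₁/2 and define the Casimir polynomials 𝔠₂ = 3(x₁y₁ + x₂y₂ + x₃y₃) + h₁² + h₁h₂ + h₂² and 𝔠₃ = 27(x₁x₂y₃ + x₃y₁y₂) + 2h₁³ + 3h₁²h₂ − 3h₁h₂² − 2h₂³ + 9[x₁y₁(h₁+2h₂) − x₂y₂(2h₁+h₂) + x₃y₃(h₁−h₂)], and the SL(2)-invariants I₁ = h₀, I₂ = h₁² + 4x₁y₁, I₃ = x₂y₂ + x₃y₃, I₆ = h₁(x₂y₂ − x₃y₃) − 2(y₁y₂x₃ + x₁x₂y₃). Then the following identities hold in ℂ[y₁,x₁,h₁,y₂,y₃,x₂,x₃,h₀]: 𝔠₂ = I₁² + (3/4)I₂ + 3I₃ and 𝔠₃ = −2I₁³ + (9/2)I₁I₂ − 9I₁I₃ −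 (27/2)I₆. -/
open MvPolynomial

/-- `h₂ = h₀ − h₁/2`. -/
noncomputable def h₂ : MvPolynomial (Fin 8) ℂ := h₀ - C (1 / 2 : ℂ) * h₁

/-- The quadratic Casimir `𝔠₂`. -/
noncomputable def c₂ : MvPolynomial (Fin 8) ℂ :=
  3 * (x₁ * y₁ + x₂ * y₂ + x₃ * y₃) + h₁ ^ 2 + h₁ * h₂ + h₂ ^ 2

/-- The cubic Casimir `𝔠₃`. -/
noncomputable def c₃ : MvPolynomial (Fin 8) ℂ :=
  27 * (x₁ * x₂ * y₃ + x₃ * y₁ * y₂) +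
    2 * h₁ ^ 3 + 3 * h₁ ^ 2 * h₂ - 3 * h₁ * h₂ ^ 2 - 2 * h₂ ^ 3 +
    9 * (x₁ * y₁ * (h₁ + 2 * h₂) - x₂ * y₂ * (2 * h₁ + h₂) + x₃ * y₃ * (h₁ - h₂))

/-- The decomposition of the Casimir invariants in terms of the `SL(2)`-invariants:
`𝔠₂ = I₁² + (3/4)I₂ + 3I₃` and `𝔠₃ = −2I₁³ + (9/2)I₁I₂ − 9I₁I₃ − (27/2)I₆`. -/
theorem casimirs_in_terms_of_sl2_invariants :
    c₂ = I₁ ^ 2 + C (3 / 4 : ℂ) * I₂ + 3 * I₃ ∧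
    c₃ = -2 * I₁ ^ 3 + C (9 / 2 : ℂ) * (I₁ * I₂) - 9 * (I₁ * I₃) - C (27 / 2 : ℂ) * I₆ := by
  have two_mul_half : 2 * (C (1 / 2 : ℂ) : MvPolynomial (Fin 8) ℂ) = 1 := by
    rw [← map_ofNat C 2, ← C_mul]
    norm_num
  have C_mul_half (n : ℂ) : (C (n / 2) : MvPolynomial (Fin 8) ℂ) = C n * C (1 / 2 : ℂ) := by
    rw [← C_mul, mul_one_div]
  have C_three_quarters :
      (C (3 / 4 : ℂ) : MvPolynomial (Fin 8) ℂ) = 3 * C (1 / 2 : ℂ) ^ 2 := by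
    rw [← map_ofNat C 3, ← C_pow, ← C_mul]
    norm_num
  rw [C_three_quarters, C_mul_half 9, C_mul_half 27, map_ofNat, map_ofNat]
  simp only [c₂, c₃, h₂, I₁, I₂, I₃, I₆]
  generalize (C (1 / 2 : ℂ) : MvPolynomial (Fin 8) ℂ) = a at two_mul_half ⊢
  constructor
  · linear_combination
      (-(3 * (2 * a + 1) * (x₁ * y₁) + (a + 1) * h₁ ^ 2 + h₀ * h₁)) * two_mul_half
  · grind
end
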